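/- arXiv:2109.02759 — 2 statements merged into one kernel-verified Lean document; each statement's English description precedes it below -/
import Mathlib

section
/- Let X be a metric space, f : X → X continuous, and N ⊆ X a nonempty compact set with f(N) ⊆ N. Suppose the restriction of f to N is topologically conjugate to the shift map on an irreducible one-sided subshift of finite type S over a finite alphabet, i.e., there is a homeomorphism h : N → S with h(f(z)) = σ(h(z)) for all z ∈ N. Then N ⊆ sα_f(x) for every x ∈ N. -/
open Set Filter Topology

section Shift

variable {A : Type*} [Fintype A] [TopologicalSpace A] [DiscreteTopology A]

/-- The one-sided shift map on `A^ℕ`. -/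
def shiftMap (s : ℕ → A) : ℕ → A := fun n => s (n + 1)

/-- A one-sided shift space: a nonempty closed shift-invariant subset of `A^ℕ`. -/
def IsShiftSpace (S : Set (ℕ → A)) : Prop :=
  S.Nonempty ∧ IsClosed S ∧ ∀ s ∈ S, shiftMap s ∈ S

/-- The word `w` occurs as a consecutive block in the sequence `s`. -/
def Occurs (w : List A) (s : ℕ → A) : Prop :=
  ∃ i : ℕ, ∀ j : ℕ, (hj : j < w.length) → s (i + j) = w.get ⟨j, hj⟩

/-- A word is admissible for `S` if it occurs in some element of `S`. -/
def Admissible (S : Set (ℕ → A)) (w : List A) : Prop :=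
  ∃ s ∈ S, Occurs w s

/-- `S` is irreducible if any two admissible words can be joined by a word so that
the concatenation is admissible. -/
def IrreducibleShift (S : Set (ℕ → A)) : Prop :=
  ∀ u v : List A, Admissible S u → Admissible S v →
    ∃ w : List A, Admissible S (u ++ w ++ v)

/-- `S` is a subshift of finite type: the set of sequences avoiding a finite set of
forbidden words. -/
def IsSFT (S : Set (ℕ → A)) : Prop :=
  ∃ F : Finset (List A), S = {s | ∀ w ∈ F, ¬ Occurs w s}

end Shift

/-- The special α-limit set of `x` under `f`. -/
def sAlpha {X : Type*} [TopologicalSpace X] (f : X → X) (x : X) : Set X :=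
  {y | ∃ (Y : ℕ → X) (k : ℕ → ℕ), Y 0 = x ∧
    (∀ n, 1 ≤ n → 1 ≤ k n ∧ f^[k n] (Y n) = Y (n - 1)) ∧
    Tendsto Y atTop (𝓝 y)}

lemma shiftMap_iterate_apply {A : Type*} (k : ℕ) (s : ℕ → A) (n : ℕ) :
    shiftMap^[k] s n = s (n + k) := by
  induction k generalizing s with
  | zero => rfl
  | succ k ih =>
    rw [Function.iterate_succ_apply, ih]
    simp only [shiftMap, add_assoc]

/-- Every finite block of an element of `S` is admissible. -/
lemma admissible_ofFn {A : Type*} {S : Set (ℕ → A)} {s : ℕ → A} (hs : s ∈ S) (n : ℕ) :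
    Admissible S (List.ofFn fun i : Fin n => s i) :=
  ⟨s, hs, 0, fun j hj => by simp⟩

/-- In an irreducible subshift of finite type, the backward orbit of each point is dense:
every cylinder contains a preimage of it under a positive iterate of the shift. -/
lemma exists_preimage_mem_cylinder {A : Type*} {S : Set (ℕ → A)} (hSFT : IsSFT S)
    (hirr : IrreducibleShift S) {s t : ℕ → A} (hs : s ∈ S) (ht : t ∈ S) (n : ℕ) :
    ∃ p ∈ S, ∃ k, 1 ≤ k ∧ shiftMap^[k] p = s ∧ ∀ j ≤ n, p j = t j := by
  obtain ⟨F, hF⟩ := hSFT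
  let L := F.sup List.length
  obtain ⟨w, r, hr, i, hi⟩ := hirr _ _ (admissible_ofFn ht (n + 1)) (admissible_ofFn hs L)
  let m := n + 1 + w.length
  have hrt : ∀ j ≤ n, r (i + j) = t j := by
    intro j hj
    rw [hi j (by simp; omega)]
    simp [-List.ofFn_succ, show j < n + 1 by omega]
  have hrs : ∀ j < L, r (i + (m + j)) = s j := by
    intro j hj
    rw [hi (m + j) (by simp [m]; omega), List.get_eq_getElem,
      List.getElem_append_right (by simp [m]; omega)]
    simp [-List.ofFn_succ, m]
  let p : ℕ → A := fun j => if j < m then r (i + j) else s (j - m)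
  have hpr : ∀ j < m + L, p j = r (i + j) := by
    intro j hj
    by_cases hjm : j < m
    · simp [p, hjm]
    · have := hrs (j - m) (by omega)
      rw [show m + (j - m) = j by omega] at this
      simp [p, hjm, this]
  have hps : ∀ j, p (m + j) = s j := fun j => by simp [p]
  refine ⟨p, ?_, m, by omega, ?_, fun j hj => ?_⟩
  · rw [hF] at hs hr ⊢
    rintro g hg ⟨a, ha⟩
    have hgL : g.length ≤ L := Finset.le_sup (f := List.length) hg
    by_cases ham : a < m
    · refine hr g hg ⟨i + a, fun j hj => ?_⟩
      rw [← ha j hj, hpr _ (by omega), add_assoc]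
    · refine hs g hg ⟨a - m, fun j hj => ?_⟩
      rw [← ha j hj, ← hps, show m + (a - m + j) = a + j by omega]
  · funext j
    rw [shiftMap_iterate_apply, add_comm, hps]
  · rw [hpr j (by omega), hrt j hj]

/-- A conjugacy with the shift intertwines the iterates. -/
lemma iterate_conj_symm {X A : Type*} [TopologicalSpace A] [TopologicalSpace X] {f : X → X}
    {S : Set (ℕ → A)} {N : Set X} (hfN : MapsTo f N N) (h : N ≃ₜ S)
    (hconj : ∀ z : N, ((h ⟨f z, hfN z.2⟩ : S) : ℕ → A) = shiftMap ((h z : ℕ → A)))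
    (k : ℕ) (p q : S) (hpq : shiftMap^[k] (p : ℕ → A) = q) :
    f^[k] (h.symm p : X) = h.symm q := by
  induction k generalizing p with
  | zero => rw [show p = q from Subtype.ext hpq]; rfl
  | succ k ih =>
    have hp := hconj (h.symm p)
    rw [h.apply_symm_apply] at hp
    rw [Function.iterate_succ_apply, ← hp] at hpq
    simpa using ih _ hpq

/-- If the restriction of `f` to a nonempty compact invariant set `N` is
topologically conjugate to the shift on an irreducible one-sided subshift of finite
type, then `N ⊆ sα_f(x)` for every `x ∈ N`. -/
theorem node_subset_sAlpha_of_conj_sft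
    {X : Type*} [MetricSpace X] (f : X → X)
    {A : Type*} [Fintype A] [TopologicalSpace A] [DiscreteTopology A]
    (S : Set (ℕ → A)) (hS : IsShiftSpace S) (hSFT : IsSFT S)
    (hirr : IrreducibleShift S)
    (N : Set X) (hne : N.Nonempty) (hcomp : IsCompact N) (hfN : MapsTo f N N)
    (h : N ≃ₜ S)
    (hconj : ∀ z : N, ((h ⟨f z, hfN z.2⟩ : S) : ℕ → A) = shiftMap ((h z : ℕ → A))) :
    ∀ x ∈ N, N ⊆ sAlpha f x := by
  intro x hx y hy
  choose P hPS K hK using fun (n : ℕ) (s : S) =>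
    exists_preimage_mem_cylinder hSFT hirr s.2 (h ⟨y, hy⟩).2 n
  let Z : ℕ → S := fun n => Nat.rec (h ⟨x, hx⟩) (fun n s => ⟨P n s, hPS n s⟩) n
  refine ⟨fun n => h.symm (Z n), fun n => K (n - 1) (Z (n - 1)), by simp [Z], ?_, ?_⟩
  · rintro (_ | n) hn
    · omega
    · exact ⟨(hK n (Z n)).1, iterate_conj_symm hfN h hconj _ _ _ (hK n (Z n)).2.1⟩
  · have hZ : Tendsto Z atTop (𝓝 (h ⟨y, hy⟩)) := by
      rw [tendsto_subtype_rng, tendsto_pi_nhds]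
      refine fun j => tendsto_const_nhds.congr' ?_
      filter_upwards [eventually_ge_atTop (j + 1)] with n hn
      obtain ⟨n, rfl⟩ : ∃ m, n = m + 1 := ⟨n - 1, by omega⟩
      exact ((hK n (Z n)).2.2 j (by omega)).symm
    have := (continuous_subtype_val.comp h.symm.continuous).continuousAt.tendsto.comp hZ
    simpa [Function.comp_def] using this
end

section
/- Under the hypotheses in the context (an S-unimodal map f with finitely many nodes N_0, …, N_p and nested cyclic trapping regions), for every x ∈ U_k with 0 ≤ k ≤ p there exists a unique index i with k ≤ i ≤ p such that ω_f(x) ⊆ N_i, where ω_f(x) = ⋂_{n≥0} closure(⋃_{m≥n} {f^m(x)}). -/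
open Set Filter Topology

/-- An S-unimodal map on `[a,b]`: a `C³` self-map of `[a,b]` with `f a = f b`,
`a` or `b` fixed, a unique critical point `c ∈ (a,b)` which is a maximum, nonzero
derivative away from `c`, and negative Schwarzian derivative away from `c`. -/
structure SUnimodal (f : ℝ → ℝ) (a b c : ℝ) : Prop where
  lt_ab : a < b
  mapsTo : MapsTo f (Icc a b) (Icc a b)
  smooth : ContDiffOn ℝ 3 f (Icc a b)
  endpoints_eq : f a = f b
  fixed_endpoint : f a = a ∨ f b = b
  c_mem : c ∈ Ioo a b
  mono : StrictMonoOn f (Icc a c)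
  anti : StrictAntiOn f (Icc c b)
  deriv_ne : ∀ x ∈ Icc a b, x ≠ c → deriv f x ≠ 0
  schwarzian_neg : ∀ x ∈ Icc a b, x ≠ c →
    deriv^[3] f x / deriv f x - (3 / 2) * (deriv^[2] f x / deriv f x) ^ 2 < 0

/-- An ε-chain from `x` to `y` for `f` with all points in the domain `D`. -/
def EpsChainOn (f : ℝ → ℝ) (D : Set ℝ) (ε : ℝ) (x y : ℝ) : Prop :=
  ∃ (n : ℕ) (cs : ℕ → ℝ), cs 0 = x ∧ cs (n + 1) = y ∧
    (∀ i ≤ n + 1, cs i ∈ D) ∧ ∀ i ≤ n, |f (cs i) - cs (i + 1)| < ε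

/-- A point is chain-recurrent if there are ε-chains from it to itself for all ε > 0. -/
def ChainRecOn (f : ℝ → ℝ) (D : Set ℝ) (x : ℝ) : Prop :=
  ∀ ε > (0 : ℝ), EpsChainOn f D ε x x

/-- Two points are chain-equivalent if there are ε-chains in both directions for all ε > 0. -/
def ChainEquivOn (f : ℝ → ℝ) (D : Set ℝ) (x y : ℝ) : Prop :=
  ∀ ε > (0 : ℝ), EpsChainOn f D ε x y ∧ EpsChainOn f D ε y x

/-- A node of `f` on the domain `D`: an equivalence class of the chain-equivalence
relation on the chain-recurrent set. -/
def IsNodeOn (f : ℝ → ℝ) (D : Set ℝ) (N : Set ℝ) : Prop :=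
  ∃ x, ChainRecOn f D x ∧ N = {y | ChainRecOn f D y ∧ ChainEquivOn f D x y}

/-- The special α-limit set of `x` under `f` regarded as a map of the domain `D`. -/
def sAlphaOn (f : ℝ → ℝ) (D : Set ℝ) (x : ℝ) : Set ℝ :=
  {y | ∃ (Y : ℕ → ℝ) (k : ℕ → ℕ), Y 0 = x ∧ (∀ n, Y n ∈ D) ∧
    (∀ n, 1 ≤ n → 1 ≤ k n ∧ f^[k n] (Y n) = Y (n - 1)) ∧
    Tendsto Y atTop (𝓝 y)}

/-- The set of non-wandering points of `f` on the domain `D`. -/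
def NonWanderingOn (f : ℝ → ℝ) (D : Set ℝ) : Set ℝ :=
  {x | x ∈ D ∧ ∀ W ∈ 𝓝[D] x, ∃ n : ℕ, 1 ≤ n ∧ (f^[n] '' (W ∩ D) ∩ W).Nonempty}

/-- The data of an S-unimodal map whose graph is a finite tower: the nodes
`N 0, …, N p`, and for each `k < p` the cyclic trapping region of `N k`, given by
the `r k` closed intervals `J k i = [Jlo k i, Jhi k i]` (`0 ≤ i < r k`, with `c` in
the interior of `J k 0`), with distinguished boundary points `pk k` (periodic, in
`N k`) and `qk k` (the other preimage of `f (pk k)`). -/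
structure TowerData where
  a : ℝ
  b : ℝ
  c : ℝ
  f : ℝ → ℝ
  p : ℕ
  N : ℕ → Set ℝ
  r : ℕ → ℕ
  Jlo : ℕ → ℕ → ℝ
  Jhi : ℕ → ℕ → ℝ
  pk : ℕ → ℝ
  qk : ℕ → ℝ

namespace TowerData

variable (T : TowerData)

/-- The `i`-th interval of the trapping region of the node `N k`. -/
def J (k i : ℕ) : Set ℝ := Icc (T.Jlo k i) (T.Jhi k i)

/-- The union of the interiors of the intervals of the trapping region of `N k`. -/
def Jint (k : ℕ) : Set ℝ := ⋃ i, ⋃ (_ : i < T.r k), Ioo (T.Jlo k i) (T.Jhi k i)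

/-- The iterates `c_m = f^m(c)` of the critical point. -/
def cit (m : ℕ) : ℝ := T.f^[m] T.c

/-- The set `V k = ⋃_{i=0}^{r k − 1} [c_{2 r_k − i}, c_{r_k − i}]`. -/
def V (k : ℕ) : Set ℝ :=
  ⋃ i, ⋃ (_ : i < T.r k), Icc (T.cit (2 * T.r k - i)) (T.cit (T.r k - i))

/-- All the hypotheses on a `TowerData`: `f` is S-unimodal with `f a = a` and
`f c < b`; the chain-recurrent set has exactly the `p+1` nodes `N 0, …, N p` with
`N 0 = {a}`; and for each `k < p` the intervals `J k i` form a cyclic trapping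
region with the stated properties, nested one inside the other. -/
structure Hyps : Prop where
  unimodal : SUnimodal T.f T.a T.b T.c
  fix_a : T.f T.a = T.a
  fc_lt : T.f T.c < T.b
  one_le_p : 1 ≤ T.p
  node : ∀ k ≤ T.p, IsNodeOn T.f (Icc T.a T.b) (T.N k)
  nodes_distinct : ∀ k ≤ T.p, ∀ j ≤ T.p, k ≠ j → T.N k ≠ T.N j
  nodes_cover : ∀ x ∈ Icc T.a T.b, ChainRecOn T.f (Icc T.a T.b) x → ∃ k ≤ T.p, x ∈ T.N k
  N0_eq : T.N 0 = {T.a}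
  r0_eq : T.r 0 = 1
  J00_lo : T.Jlo 0 0 = T.a
  J00_hi : T.Jhi 0 0 = T.b
  r_pos : ∀ k < T.p, 1 ≤ T.r k
  J_le : ∀ k < T.p, ∀ i < T.r k, T.Jlo k i ≤ T.Jhi k i
  J_sub : ∀ k < T.p, ∀ i < T.r k, T.J k i ⊆ Icc T.a T.b
  J_disjoint : ∀ k < T.p, ∀ i < T.r k, ∀ j < T.r k, i ≠ j →
    Ioo (T.Jlo k i) (T.Jhi k i) ∩ Ioo (T.Jlo k j) (T.Jhi k j) = ∅
  c_mem_J0 : ∀ k < T.p, T.c ∈ Ioo (T.Jlo k 0) (T.Jhi k 0)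
  f_J : ∀ k < T.p, ∀ i < T.r k, T.f '' T.J k i ⊆ T.J k ((i + 1) % T.r k)
  J0_endpoints : ∀ k < T.p,
    (T.Jlo k 0 = T.pk k ∧ T.Jhi k 0 = T.qk k) ∨
    (T.Jlo k 0 = T.qk k ∧ T.Jhi k 0 = T.pk k)
  pk_periodic : ∀ k < T.p, ∃ m : ℕ, 1 ≤ m ∧ T.f^[m] (T.pk k) = T.pk k
  pk_mem : ∀ k < T.p, T.pk k ∈ T.N k
  qk_preim : ∀ k < T.p, T.f (T.qk k) = T.f (T.pk k)
  f_endpoints : ∀ k < T.p, ∀ i < T.r k,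
    T.f (T.Jlo k i) ∈ ({T.Jlo k ((i + 1) % T.r k), T.Jhi k ((i + 1) % T.r k)} : Set ℝ) ∧
    T.f (T.Jhi k i) ∈ ({T.Jlo k ((i + 1) % T.r k), T.Jhi k ((i + 1) % T.r k)} : Set ℝ)
  N_Jint_disj : ∀ k < T.p, T.N k ∩ T.Jint k = ∅
  N_sub_Jint : ∀ k < T.p, ∀ j ≤ T.p, k < j → T.N j ⊆ T.Jint k
  nested : ∀ k, 1 ≤ k → k ≤ T.p - 1 → closure (T.Jint k) ⊆ T.Jint (k - 1)

end TowerData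

open Relation

/-- One step of an `ε`-chain inside `D`. -/
def ChainStep (f : ℝ → ℝ) (D : Set ℝ) (ε : ℝ) (u v : ℝ) : Prop :=
  u ∈ D ∧ v ∈ D ∧ |f u - v| < ε

theorem epsChainOn_iff_transGen {f : ℝ → ℝ} {D : Set ℝ} {ε x y : ℝ} :
    EpsChainOn f D ε x y ↔ TransGen (ChainStep f D ε) x y := by
  constructor
  · rintro ⟨n, cs, rfl, rfl, hD, h⟩
    induction n with
    | zero => exact .single ⟨hD 0 (by omega), hD 1 (by omega), h 0 (by omega)⟩
    | succ n ih =>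
      exact (ih (fun i hi => hD i (by omega)) (fun i hi => h i (by omega))).tail
        ⟨hD _ (by omega), hD _ (by omega), h _ (by omega)⟩
  · intro h
    induction h using TransGen.head_induction_on with
    | single h =>
      rename_i u
      refine ⟨0, fun i => if i = 0 then u else y, by simp, by simp, ?_, ?_⟩
      · intro i _
        by_cases hi : i = 0
        · simpa [hi] using h.1
        · simpa [hi] using h.2.1
      · intro i hi
        obtain rfl : i = 0 := by omega
        simpa using h.2.2
    | head h hvy ih =>
      rename_i u v
      obtain ⟨n, cs, h0, h1, hD, hs⟩ := ih
      refine ⟨n + 1, fun i => if i = 0 then u else cs (i - 1), by simp, by simpa using h1, ?_, ?_⟩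
      · intro i hi
        by_cases h' : i = 0
        · simpa [h'] using h.1
        · simpa [h'] using hD (i - 1) (by omega)
      · rintro (_ | i) hi
        · simpa [h0] using h.2.2
        · simpa using hs i (by omega)

/-- The `ω`-limit set of the orbit of `x`. -/
def orbitOmega (f : ℝ → ℝ) (x : ℝ) : Set ℝ :=
  ⋂ n : ℕ, closure (⋃ m, ⋃ (_ : n ≤ m), ({f^[m] x} : Set ℝ))

theorem mem_orbitOmega_iff {f : ℝ → ℝ} {x y : ℝ} :
    y ∈ orbitOmega f x ↔ ∀ n : ℕ, ∀ ε > (0 : ℝ), ∃ m ≥ n, |f^[m] x - y| < ε := by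
  simp only [orbitOmega, mem_iInter, Metric.mem_closure_iff, mem_iUnion, mem_singleton_iff,
    Real.dist_eq]
  refine forall_congr' fun n => forall_congr' fun ε => forall_congr' fun _ => ?_
  constructor
  · rintro ⟨_, ⟨m, hm, rfl⟩, h⟩
    exact ⟨m, hm, by rwa [abs_sub_comm]⟩
  · rintro ⟨m, hm, h⟩
    exact ⟨_, ⟨m, hm, rfl⟩, by rwa [abs_sub_comm]⟩

theorem orbitOmega_nonempty {f : ℝ → ℝ} {D : Set ℝ} {x : ℝ} (hD : IsCompact D)
    (h : ∀ n, f^[n] x ∈ D) : (orbitOmega f x).Nonempty := by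
  obtain ⟨y, _, φ, hφ, hy⟩ := hD.tendsto_subseq h
  refine ⟨y, mem_orbitOmega_iff.2 fun n ε hε => ?_⟩
  obtain ⟨N, hN⟩ := Metric.tendsto_atTop.1 hy ε hε
  exact ⟨φ (max n N), (le_max_left _ _).trans (hφ.id_le _), hN _ (le_max_right _ _)⟩

theorem orbitOmega_subset {f : ℝ → ℝ} {H : Set ℝ} {x : ℝ} (hH : IsClosed H)
    (h : ∀ n, f^[n] x ∈ H) : orbitOmega f x ⊆ H := by
  intro y hy
  rw [← hH.closure_eq, Metric.mem_closure_iff]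
  intro ε hε
  obtain ⟨m, _, hm⟩ := mem_orbitOmega_iff.1 hy 0 ε hε
  exact ⟨_, h m, by rwa [dist_comm]⟩

theorem Set.MapsTo.iterate_mem {f : ℝ → ℝ} {D : Set ℝ} (h : MapsTo f D D) {x : ℝ} (hx : x ∈ D)
    (n : ℕ) : f^[n] x ∈ D :=
  h.iterate n hx

section Chains

variable {f : ℝ → ℝ} {D : Set ℝ} {x y z : ℝ}

/-- Following the orbit of a point, one reaches every point close to a later iterate. -/
theorem transGen_chainStep_of_iterate (hf : MapsTo f D D) {ε : ℝ} (hε : 0 < ε) (hy : y ∈ D)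
    (n : ℕ) : ∀ w ∈ D, |f^[n + 1] w - y| < ε → TransGen (ChainStep f D ε) w y := by
  induction n with
  | zero => exact fun w hw h => .single ⟨hw, hy, by simpa using h⟩
  | succ n ih =>
    exact fun w hw h => .head ⟨hw, hf hw, by simpa using hε⟩ (ih (f w) (hf hw) h)

theorem transGen_to_orbitOmega (hf : MapsTo f D D) (hD : IsClosed D) (hx : x ∈ D)
    (hy : y ∈ orbitOmega f x) {ε : ℝ} (hε : 0 < ε) : TransGen (ChainStep f D ε) x y := by
  obtain ⟨m, hm, h⟩ := mem_orbitOmega_iff.1 hy 1 ε hε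
  obtain ⟨m, rfl⟩ : ∃ j, m = j + 1 := ⟨m - 1, by omega⟩
  exact transGen_chainStep_of_iterate hf hε (orbitOmega_subset hD (hf.iterate_mem hx) hy) m x hx h

/-- A limit point of an orbit is joined by one step to an iterate. -/
theorem chainStep_of_mem_orbitOmega (hf : MapsTo f D D) (hc : ContinuousOn f D) (hD : IsClosed D)
    (hx : x ∈ D) (hy : y ∈ orbitOmega f x) {ε : ℝ} (hε : 0 < ε) :
    ∃ m, ChainStep f D ε y (f^[m] x) := by
  have hyD : y ∈ D := orbitOmega_subset hD (hf.iterate_mem hx) hy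
  obtain ⟨δ, hδ, h⟩ := Metric.continuousOn_iff.1 hc y hyD ε hε
  obtain ⟨m, _, hm⟩ := mem_orbitOmega_iff.1 hy 0 δ hδ
  refine ⟨m + 1, hyD, hf.iterate_mem hx _, ?_⟩
  rw [abs_sub_comm, Function.iterate_succ_apply']
  exact h _ (hf.iterate_mem hx m) hm

theorem orbitOmega_iterate {m : ℕ} (hy : y ∈ orbitOmega f x) : y ∈ orbitOmega f (f^[m] x) := by
  refine mem_orbitOmega_iff.2 fun n ε hε => ?_
  obtain ⟨j, hj, h⟩ := mem_orbitOmega_iff.1 hy (n + m) ε hε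
  refine ⟨j - m, by omega, ?_⟩
  rwa [← Function.iterate_add_apply, Nat.sub_add_cancel (by omega)]

theorem epsChainOn_of_mem_orbitOmega (hf : MapsTo f D D) (hc : ContinuousOn f D)
    (hD : IsClosed D) (hx : x ∈ D) (hy : y ∈ orbitOmega f x) (hz : z ∈ orbitOmega f x)
    {ε : ℝ} (hε : 0 < ε) : EpsChainOn f D ε y z := by
  obtain ⟨m, hm⟩ := chainStep_of_mem_orbitOmega hf hc hD hx hy hε
  exact epsChainOn_iff_transGen.2 (.head hm
    (transGen_to_orbitOmega hf hD (hf.iterate_mem hx m) (orbitOmega_iterate hz) hε))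

/-- If `y` chain-reaches a chain-recurrent point `x`, then so does `f y`. -/
theorem transGen_map_left (hf : MapsTo f D D) (hc : ContinuousOn f D) (hx : ChainRecOn f D x)
    (hy : y ∈ D) (h : ∀ ε > (0 : ℝ), TransGen (ChainStep f D ε) y x) :
    ∀ ε > (0 : ℝ), TransGen (ChainStep f D ε) (f y) x := by
  intro ε hε
  obtain ⟨δ, hδ, hcont⟩ := Metric.continuousOn_iff.1 hc (f y) (hf hy) (ε / 2) (half_pos hε)
  set η := min δ (ε / 2)
  have hη : 0 < η := lt_min hδ (half_pos hε)
  obtain ⟨u, hyu, hux⟩ : ∃ u, ChainStep f D η y u ∧ TransGen (ChainStep f D η) u x := by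
    rcases TransGen.head'_iff.1 (h η hη) with ⟨u, hyu, hux⟩
    exact ⟨u, hyu, TransGen.trans_right hux (epsChainOn_iff_transGen.1 (hx η hη))⟩
  obtain ⟨v, huv, hvx⟩ := TransGen.head'_iff.1 hux
  have hfu : |f u - f (f y)| < ε / 2 := by
    refine hcont u hyu.2.1 ?_
    rw [Real.dist_eq, abs_sub_comm]
    exact hyu.2.2.trans_le (min_le_left _ _)
  have hstep : ChainStep f D ε (f y) v := by
    refine ⟨hf hy, huv.2.1, ?_⟩
    have h2 : |f u - v| < ε / 2 := huv.2.2.trans_le (min_le_right _ _)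
    rw [abs_lt] at *
    constructor <;> linarith
  have hηε : η ≤ ε := (min_le_right _ _).trans (by linarith)
  exact TransGen.head' hstep
    (ReflTransGen.mono (fun _ _ hs => ⟨hs.1, hs.2.1, hs.2.2.trans_le hηε⟩) _ _ hvx)

theorem transGen_iterate_left (hf : MapsTo f D D) (hc : ContinuousOn f D) (hx : ChainRecOn f D x)
    (hxD : x ∈ D) (m : ℕ) : ∀ ε > (0 : ℝ), TransGen (ChainStep f D ε) (f^[m] x) x := by
  induction m with
  | zero => exact fun ε hε => epsChainOn_iff_transGen.1 (hx ε hε)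
  | succ m ih =>
    rw [Function.iterate_succ_apply']
    exact transGen_map_left hf hc hx (hf.iterate_mem hxD m) ih

theorem ChainRecOn.mem (hx : ChainRecOn f D x) : x ∈ D := by
  obtain ⟨n, cs, h0, _, h, _⟩ := hx 1 one_pos
  exact h0 ▸ h 0 (by omega)

theorem ChainEquivOn.trans (hxy : ChainEquivOn f D x y) (hyz : ChainEquivOn f D y z) :
    ChainEquivOn f D x z := fun ε hε => by
  have h := hxy ε hε
  have h' := hyz ε hε
  simp only [epsChainOn_iff_transGen] at *
  exact ⟨h.1.trans h'.1, h'.2.trans h.2⟩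

theorem ChainEquivOn.symm (hxy : ChainEquivOn f D x y) : ChainEquivOn f D y x :=
  fun ε hε => (hxy ε hε).symm

/-- A chain-recurrent point is chain-equivalent to its limit points. -/
theorem chainEquivOn_orbitOmega (hf : MapsTo f D D) (hc : ContinuousOn f D) (hD : IsClosed D)
    (hx : ChainRecOn f D x) (hy : y ∈ orbitOmega f x) : ChainEquivOn f D x y := by
  intro ε hε
  obtain ⟨m, hm⟩ := chainStep_of_mem_orbitOmega hf hc hD hx.mem hy hε
  exact ⟨epsChainOn_iff_transGen.2 (transGen_to_orbitOmega hf hD hx.mem hy hε),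
    epsChainOn_iff_transGen.2 (.head hm (transGen_iterate_left hf hc hx hx.mem m ε hε))⟩

theorem chainRecOn_of_mem_orbitOmega (hf : MapsTo f D D) (hc : ContinuousOn f D)
    (hD : IsClosed D) (hx : x ∈ D) (hy : y ∈ orbitOmega f x) : ChainRecOn f D y :=
  fun _ hε => epsChainOn_of_mem_orbitOmega hf hc hD hx hy hy hε

theorem IsNodeOn.mem_of_equiv {N : Set ℝ} (hN : IsNodeOn f D N) (hy : y ∈ N)
    (hz : ChainRecOn f D z) (h : ChainEquivOn f D y z) : z ∈ N := by
  obtain ⟨w, _, rfl⟩ := hN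
  exact ⟨hz, hy.2.trans h⟩

theorem IsNodeOn.chainRecOn {N : Set ℝ} (hN : IsNodeOn f D N) (hy : y ∈ N) : ChainRecOn f D y := by
  obtain ⟨w, _, rfl⟩ := hN
  exact hy.1

theorem IsNodeOn.eq_of_mem {N M : Set ℝ} (hN : IsNodeOn f D N) (hM : IsNodeOn f D M)
    (hy : y ∈ N) (hy' : y ∈ M) : N = M := by
  obtain ⟨w, _, rfl⟩ := hN
  obtain ⟨v, _, rfl⟩ := hM
  ext z
  exact ⟨fun hz => ⟨hz.1, hy'.2.trans (hy.2.symm.trans hz.2)⟩,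
    fun hz => ⟨hz.1, hy.2.trans (hy'.2.symm.trans hz.2)⟩⟩

end Chains

/-- A unimodal map on a subinterval is bounded below by its value at one of the endpoints. -/
theorem SUnimodal.min_le {f : ℝ → ℝ} {a b c u v y : ℝ} (h : SUnimodal f a b c) (hu : a ≤ u)
    (hv : v ≤ b) (huy : u ≤ y) (hyv : y ≤ v) : f u ≤ f y ∨ f v ≤ f y := by
  rcases le_total y c with hy | hy
  · exact .inl (h.mono.monotoneOn ⟨hu, huy.trans hy⟩ ⟨hu.trans huy, hy⟩ huy)
  · exact .inr (h.anti.antitoneOn ⟨hy, hyv.trans hv⟩ ⟨hy.trans hyv, hv⟩ hyv)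

theorem SUnimodal.le_apply_c {f : ℝ → ℝ} {a b c y : ℝ} (h : SUnimodal f a b c)
    (hy : y ∈ Icc a b) : f y ≤ f c := by
  rcases le_total y c with hyc | hyc
  · exact h.mono.monotoneOn ⟨hy.1, hyc⟩ ⟨h.c_mem.1.le, le_rfl⟩ hyc
  · exact h.anti.antitoneOn ⟨le_rfl, h.c_mem.2.le⟩ ⟨hyc, hy.2⟩ hyc

/-- The value of a unimodal map at a point of `[u, v]` is at most its value at `u`, at `v`, or,
if `c` lies in `[u, v]`, at `c`. -/
theorem SUnimodal.le_max {f : ℝ → ℝ} {a b c u v y : ℝ} (h : SUnimodal f a b c) (hu : a ≤ u)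
    (hv : v ≤ b) (huy : u ≤ y) (hyv : y ≤ v) :
    f y ≤ f u ∨ f y ≤ f v ∨ c ∈ Icc u v ∧ f y ≤ f c := by
  by_cases hc : c ∈ Icc u v
  · exact .inr (.inr ⟨hc, h.le_apply_c ⟨hu.trans huy, hyv.trans hv⟩⟩)
  · rcases lt_or_ge c u with hcu | huc
    · exact .inl (h.anti.antitoneOn ⟨hcu.le, huy.trans (hyv.trans hv)⟩
        ⟨hcu.le.trans huy, hyv.trans hv⟩ huy)
    · have hvc : v < c := not_le.1 fun hvc => hc ⟨huc, hvc⟩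
      exact .inr (.inl (h.mono.monotoneOn ⟨hu.trans huy, hyv.trans hvc.le⟩
        ⟨hu.trans (huy.trans hyv), hvc.le⟩ hyv))

namespace TowerData

variable {T : TowerData}

/-- The closed trapping region of the node `N k`. -/
def region (T : TowerData) (k : ℕ) : Set ℝ := ⋃ i ∈ Finset.range (T.r k), T.J k i

theorem mem_region {k : ℕ} {x : ℝ} : x ∈ T.region k ↔ ∃ i < T.r k, x ∈ T.J k i := by
  simp [region]

/-- The order-convex hull of the points of `region (k + 1)` lying in the interval `J k i`. -/
def coreHull (T : TowerData) (k i : ℕ) : Set ℝ :=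
  {y | ∃ u ∈ T.region (k + 1) ∩ T.J k i, ∃ v ∈ T.region (k + 1) ∩ T.J k i, u ≤ y ∧ y ≤ v}

theorem isClosed_coreHull (k i : ℕ) : IsClosed (T.coreHull k i) := by
  have hK : IsCompact (T.region (k + 1) ∩ T.J k i) :=
    (Finset.isCompact_biUnion _ fun _ _ => isCompact_Icc).inter_right isClosed_Icc
  rcases (T.region (k + 1) ∩ T.J k i).eq_empty_or_nonempty with h | h
  · simp [coreHull, h]
  · obtain ⟨u, hu⟩ := hK.exists_isLeast h
    obtain ⟨v, hv⟩ := hK.exists_isGreatest h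
    have : T.coreHull k i = Icc u v := by
      ext y
      exact ⟨fun ⟨u', hu', v', hv', h1, h2⟩ => ⟨(hu.2 hu').trans h1, h2.trans (hv.2 hv')⟩,
        fun hy => ⟨u, hu.1, v, hv.1, hy.1, hy.2⟩⟩
    exact this ▸ isClosed_Icc

/-- The union of the hulls `coreHull k i`. -/
def core (T : TowerData) (k : ℕ) : Set ℝ := ⋃ i ∈ Finset.range (T.r k), T.coreHull k i

theorem mem_core {k : ℕ} {x : ℝ} : x ∈ T.core k ↔ ∃ i < T.r k, x ∈ T.coreHull k i := by
  simp [core]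

theorem isClosed_core (k : ℕ) : IsClosed (T.core k) :=
  Set.Finite.isClosed_biUnion (Finset.finite_toSet _) fun i _ => isClosed_coreHull k i

theorem mem_Jint {k : ℕ} {x : ℝ} :
    x ∈ T.Jint k ↔ ∃ i < T.r k, x ∈ Ioo (T.Jlo k i) (T.Jhi k i) := by
  simp only [Jint, mem_iUnion, exists_prop]

namespace Hyps

theorem continuousOn (hT : T.Hyps) : ContinuousOn T.f (Icc T.a T.b) :=
  hT.unimodal.smooth.continuousOn

theorem apply_mem_J (hT : T.Hyps) {k i : ℕ} (hk : k < T.p) (hi : i < T.r k) {x : ℝ}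
    (hx : x ∈ T.J k i) :
    T.f x ∈ T.J k ((i + 1) % T.r k) :=
  hT.f_J k hk i hi (mem_image_of_mem _ hx)

theorem mapsTo_region (hT : T.Hyps) {k : ℕ} (hk : k < T.p) :
    MapsTo T.f (T.region k) (T.region k) := by
  intro x hx
  obtain ⟨i, hi, hx⟩ := mem_region.1 hx
  exact mem_region.2 ⟨_, Nat.mod_lt _ (hT.r_pos k hk), hT.apply_mem_J hk hi hx⟩

theorem cit_mem_J (hT : T.Hyps) {k : ℕ} (hk : k < T.p) (n : ℕ) : T.cit n ∈ T.J k (n % T.r k) := by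
  induction n with
  | zero => simpa [cit, J] using Ioo_subset_Icc_self (hT.c_mem_J0 k hk)
  | succ n ih =>
    have := hT.apply_mem_J hk (Nat.mod_lt _ (hT.r_pos k hk)) ih
    rwa [Nat.mod_add_mod, ← show T.cit (n + 1) = T.f (T.cit n) from
      Function.iterate_succ_apply' _ _ _] at this

theorem cit_mem_region (hT : T.Hyps) {k : ℕ} (hk : k < T.p) (n : ℕ) : T.cit n ∈ T.region k :=
  mem_region.2 ⟨_, Nat.mod_lt _ (hT.r_pos k hk), hT.cit_mem_J hk n⟩

theorem Jlo_lt_Jhi_mod (hT : T.Hyps) {k : ℕ} (hk : k < T.p) (n : ℕ) :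
    T.Jlo k (n % T.r k) < T.Jhi k (n % T.r k) := by
  induction n with
  | zero => simpa using (hT.c_mem_J0 k hk).1.trans (hT.c_mem_J0 k hk).2
  | succ n ih =>
    have hi := Nat.mod_lt n (hT.r_pos k hk)
    rw [← Nat.mod_add_mod]
    set i := n % T.r k
    have hsub := hT.J_sub k hk i hi
    have hlo : T.Jlo k i ∈ T.J k i := ⟨le_rfl, ih.le⟩
    have hhi : T.Jhi k i ∈ T.J k i := ⟨ih.le, le_rfl⟩
    obtain ⟨u, hu, v, hv, huv⟩ : ∃ u ∈ T.J k i, ∃ v ∈ T.J k i, T.f u < T.f v := by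
      rcases lt_or_ge (T.Jlo k i) T.c with hc | hc
      · refine ⟨_, hlo, min (T.Jhi k i) T.c, ⟨le_min ih.le hc.le, min_le_left _ _⟩, ?_⟩
        exact hT.unimodal.mono ⟨(hsub hlo).1, hc.le⟩
          ⟨(hsub hlo).1.trans (le_min ih.le hc.le), min_le_right _ _⟩ (lt_min ih hc)
      · exact ⟨_, hhi, _, hlo, hT.unimodal.anti ⟨hc, (hsub hlo).2⟩
          ⟨hc.trans ih.le, (hsub hhi).2⟩ ih⟩
    exact ((hT.apply_mem_J hk hi hu).1.trans_lt huv).trans_le (hT.apply_mem_J hk hi hv).2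

theorem region_subset_closure_Jint (hT : T.Hyps) {k : ℕ} (hk : k < T.p) :
    T.region k ⊆ closure (T.Jint k) := by
  intro x hx
  obtain ⟨i, hi, hx⟩ := mem_region.1 hx
  have hne := hT.Jlo_lt_Jhi_mod hk i
  rw [Nat.mod_eq_of_lt hi] at hne
  rw [J, ← closure_Ioo hne.ne] at hx
  exact closure_mono (fun y hy => mem_Jint.2 ⟨i, hi, hy⟩) hx

theorem region_subset_Jint (hT : T.Hyps) {k : ℕ} (hk : k + 1 < T.p) : T.region (k + 1) ⊆ T.Jint k :=
  (hT.region_subset_closure_Jint hk).trans (hT.nested (k + 1) (by omega) (by omega))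

theorem Jint_subset (hT : T.Hyps) {j k : ℕ} (hjk : j ≤ k) (hk : k < T.p) : T.Jint k ⊆ T.Jint j := by
  induction k, hjk using Nat.le_induction with
  | base => exact Subset.rfl
  | succ k _ ih =>
    exact subset_closure.trans ((hT.nested (k + 1) (by omega) (by omega)).trans (ih (by omega)))

theorem mapsTo_core (hT : T.Hyps) {k : ℕ} (hk : k + 1 < T.p) :
    MapsTo T.f (T.core k) (T.core k) := by
  intro y hy
  obtain ⟨i, hi, u, hu, v, hv, huy, hyv⟩ := mem_core.1 hy
  have hk' : k < T.p := by omega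
  have hsub := hT.J_sub k hk' i hi
  have hmem : ∀ w ∈ T.region (k + 1) ∩ T.J k i,
      T.f w ∈ T.region (k + 1) ∩ T.J k ((i + 1) % T.r k) :=
    fun w hw => ⟨hT.mapsTo_region hk hw.1, hT.apply_mem_J hk' hi hw.2⟩
  refine mem_core.2 ⟨_, Nat.mod_lt (i + 1) (hT.r_pos k hk'), ?_⟩
  obtain ⟨s, hs, hsy⟩ : ∃ s ∈ T.region (k + 1) ∩ T.J k i, T.f s ≤ T.f y := by
    rcases hT.unimodal.min_le (hsub hu.2).1 (hsub hv.2).2 huy hyv with h | h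
    exacts [⟨u, hu, h⟩, ⟨v, hv, h⟩]
  obtain ⟨t, ht, hyt⟩ : ∃ t ∈ T.region (k + 1) ∩ T.J k i, T.f y ≤ T.f t := by
    rcases hT.unimodal.le_max (hsub hu.2).1 (hsub hv.2).2 huy hyv with h | h | ⟨hc, h⟩
    · exact ⟨u, hu, h⟩
    · exact ⟨v, hv, h⟩
    · exact ⟨T.c, ⟨hT.cit_mem_region hk 0, hu.2.1.trans hc.1, hc.2.trans hv.2.2⟩, h⟩
  exact ⟨_, hmem s hs, _, hmem t ht, hsy, hyt⟩

/-- A point of `J k i` in the open trapping region is an interior point of `J k i`. -/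
theorem mem_Ioo_of_mem_J (hT : T.Hyps) {k i : ℕ} (hk : k < T.p) (hi : i < T.r k) {x : ℝ}
    (hx : x ∈ T.J k i)
    (hx' : x ∈ T.Jint k) : x ∈ Ioo (T.Jlo k i) (T.Jhi k i) := by
  obtain ⟨j, hj, hxj⟩ := mem_Jint.1 hx'
  by_cases hij : i = j
  · exact hij ▸ hxj
  · have hne := hT.Jlo_lt_Jhi_mod hk i
    rw [Nat.mod_eq_of_lt hi] at hne
    have hdisj : Disjoint (Ioo (T.Jlo k i) (T.Jhi k i)) (Ioo (T.Jlo k j) (T.Jhi k j)) :=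
      disjoint_iff_inter_eq_empty.2 (hT.J_disjoint k hk i hi j hj hij)
    have hcl := hdisj.closure_left isOpen_Ioo
    rw [closure_Ioo hne.ne] at hcl
    exact (disjoint_left.1 hcl hx hxj).elim

theorem core_subset_Jint (hT : T.Hyps) {k : ℕ} (hk : k + 1 < T.p) : T.core k ⊆ T.Jint k := by
  intro y hy
  obtain ⟨i, hi, u, hu, v, hv, huy, hyv⟩ := mem_core.1 hy
  have hk' : k < T.p := by omega
  have hu' := hT.mem_Ioo_of_mem_J hk' hi hu.2 (hT.region_subset_Jint hk hu.1)
  have hv' := hT.mem_Ioo_of_mem_J hk' hi hv.2 (hT.region_subset_Jint hk hv.1)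
  exact mem_Jint.2 ⟨i, hi, hu'.1.trans_le huy, hyv.trans_lt hv'.2⟩

theorem V_subset_core (hT : T.Hyps) {k : ℕ} (hk : k + 1 < T.p) : T.V k ⊆ T.core k := by
  intro x hx
  simp only [V, mem_iUnion, exists_prop] at hx
  obtain ⟨i, hi, hx⟩ := hx
  have hk' : k < T.p := by omega
  have hmod : (2 * T.r k - i) % T.r k = (T.r k - i) % T.r k := by
    rw [show 2 * T.r k - i = (T.r k - i) + T.r k by omega, Nat.add_mod_right]
  exact mem_core.2 ⟨_, Nat.mod_lt (T.r k - i) (hT.r_pos k hk'),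
    _, ⟨hT.cit_mem_region hk _, hmod ▸ hT.cit_mem_J hk' _⟩,
    _, ⟨hT.cit_mem_region hk _, hT.cit_mem_J hk' _⟩, hx.1, hx.2⟩

theorem Jint_subset_Icc (hT : T.Hyps) {k : ℕ} (hk : k < T.p) : T.Jint k ⊆ Icc T.a T.b := by
  intro x hx
  obtain ⟨i, hi, hx⟩ := mem_Jint.1 hx
  exact hT.J_sub k hk i hi (Ioo_subset_Icc_self hx)

/-- Every limit set of an orbit lies in exactly one node. -/
theorem existsUnique_node_orbitOmega (hT : T.Hyps) {x : ℝ} (hx : x ∈ Icc T.a T.b) :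
    ∃! i : ℕ, i ≤ T.p ∧ orbitOmega T.f x ⊆ T.N i := by
  have hm := hT.unimodal.mapsTo
  have hc := hT.continuousOn
  obtain ⟨y, hy⟩ := orbitOmega_nonempty isCompact_Icc (hm.iterate_mem hx)
  have hrec : ∀ z ∈ orbitOmega T.f x, ChainRecOn T.f (Icc T.a T.b) z :=
    fun z hz => chainRecOn_of_mem_orbitOmega hm hc isClosed_Icc hx hz
  obtain ⟨i, hi, hyi⟩ := hT.nodes_cover y (hrec y hy).mem (hrec y hy)
  refine ⟨i, ⟨hi, fun z hz => (hT.node i hi).mem_of_equiv hyi (hrec z hz) fun ε hε => ?_⟩, ?_⟩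
  · exact ⟨epsChainOn_of_mem_orbitOmega hm hc isClosed_Icc hx hy hz hε,
      epsChainOn_of_mem_orbitOmega hm hc isClosed_Icc hx hz hy hε⟩
  · rintro j ⟨hj, hsub⟩
    by_contra hne
    exact hT.nodes_distinct j hj i hi hne
      ((hT.node j hj).eq_of_mem (hT.node i hi) (hsub hy) hyi)

end Hyps

end TowerData

/-- ω-limits of an S-unimodal map: if `x ∈ U_k` with `0 ≤ k ≤ p`, then there is a
unique index `i` with `k ≤ i ≤ p` such that `ω_f(x) ⊆ N_i`. -/
theorem omega_limit_hierarchy (T : TowerData) (hT : T.Hyps)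
    (U : ℕ → Set ℝ)
    (hUp : U T.p = T.N T.p)
    (hUmid : ∀ k, 1 ≤ k → k + 1 ≤ T.p →
      U k = T.V (k - 1) \ ⋃ j, ⋃ (_ : k < j ∧ j ≤ T.p), U j)
    (hU0 : U 0 = Ico T.a (T.cit 2)) :
    ∀ k ≤ T.p, ∀ x ∈ U k, ∃! i : ℕ, (k ≤ i ∧ i ≤ T.p) ∧
      (⋂ n : ℕ, closure (⋃ m, ⋃ (_ : n ≤ m), ({T.f^[m] x} : Set ℝ))) ⊆ T.N i := by
  have key : ∀ k, ∀ x ∈ Icc T.a T.b,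
      (∀ i ≤ T.p, orbitOmega T.f x ⊆ T.N i → k ≤ i) →
      ∃! i : ℕ, (k ≤ i ∧ i ≤ T.p) ∧ orbitOmega T.f x ⊆ T.N i := by
    intro k x hx hle
    obtain ⟨i, ⟨hi, hsub⟩, huniq⟩ := hT.existsUnique_node_orbitOmega hx
    exact ⟨i, ⟨⟨hle i hi hsub, hi⟩, hsub⟩, fun j hj => huniq j ⟨hj.1.2, hj.2⟩⟩
  have hm := hT.unimodal.mapsTo
  have hc : T.c ∈ Icc T.a T.b := Ioo_subset_Icc_self hT.unimodal.c_mem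
  intro k hk x hx
  rcases eq_or_ne k T.p with rfl | hkp
  · rw [hUp] at hx
    have hrec := (hT.node _ le_rfl).chainRecOn hx
    refine key _ x hrec.mem fun i hi hsub => ?_
    obtain ⟨j, _, huniq⟩ := hT.existsUnique_node_orbitOmega hrec.mem
    have hp : orbitOmega T.f x ⊆ T.N T.p := fun z hz =>
      (hT.node _ le_rfl).mem_of_equiv hx
        (chainRecOn_of_mem_orbitOmega hm hT.continuousOn isClosed_Icc hrec.mem hz)
        (chainEquivOn_orbitOmega hm hT.continuousOn isClosed_Icc hrec hz)
    rw [huniq i ⟨hi, hsub⟩, huniq T.p ⟨le_rfl, hp⟩]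
  rcases k with _ | k
  · rw [hU0] at hx
    exact key 0 x ⟨hx.1, hx.2.le.trans (hm.iterate_mem hc 2).2⟩ fun _ _ _ => Nat.zero_le _
  · have hk' : k + 1 < T.p := by omega
    rw [hUmid (k + 1) (by omega) hk'] at hx
    have hcore := hT.V_subset_core hk' hx.1
    have hxD := hT.Jint_subset_Icc (by omega) (hT.core_subset_Jint hk' hcore)
    refine key _ x hxD fun i hi hsub => ?_
    by_contra hlt
    obtain ⟨y, hy⟩ := orbitOmega_nonempty isCompact_Icc (hm.iterate_mem hxD)
    have hyJ : y ∈ T.Jint i := hT.Jint_subset (by omega : i ≤ k) (by omega)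
      (hT.core_subset_Jint hk' (orbitOmega_subset (T.isClosed_core k)
        ((hT.mapsTo_core hk').iterate_mem hcore) hy))
    exact (hT.N_Jint_disj i (by omega)).le ⟨hsub hy, hyJ⟩
end
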